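/- arXiv:2405.14593 — 5 statements merged into one kernel-verified Lean document; each statement's English description precedes it below -/
import Mathlib

section
/- Let L > 0 and 0 < Γ < L/2, set δ = ρ·α³·L⁴ and σ = Γ/L. Then (ξ,η) = (0,0) is a critical point of the map (ξ,η) ↦ H_AV(ξ,η,Γ;L), its Hessian there is diagonal, and ∂²H_AV/∂ξ²(0,0,Γ;L) = (3ρ₀/(16L⁷))·(𝐚(σ) + δ·𝐜₊(σ)), ∂²H_AV/∂η²(0,0,Γ;L) = (3ρ₀/(16L⁷))·(𝐚(σ) + δ·𝐜₋(σ)), ∂²H_AV/∂ξ∂η(0,0,Γ;L) = 0. Consequently, the linearization at the origin of the planar Hamiltonian system ξ' = −∂H_AV/∂η, η' = ∂H_AV/∂ξ (with Γ, L fixed) has eigenvalues ±λ with λ² = −(9ρ₀²/(256·L¹⁴))·(𝐚(σ)+δ·𝐜₊(σ))·(𝐚(σ)+δ·𝐜₋(σ)). -/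
noncomputable section
open Real Set

namespace Secular

def U00 : ℝ := 0.762646
def U10 : ℝ := 0.547442
def U20 : ℝ := 0.237353
def mC : ℝ := (-4 + Real.sqrt 21) / 5
def rhoC : ℝ := 1.762157978551987e-18
def muC : ℝ := 398600.44
def aM : ℝ := 384400
def aMin : ℝ := 6378.14
def aMax : ℝ := 30000
def Lmin : ℝ := Real.sqrt (muC * aMin)
def Lmax : ℝ := Real.sqrt (muC * aMax)
def deltaFun (L : ℝ) : ℝ := rhoC * L ^ 10 / (muC ^ 3 * aM ^ 3)
def deltaMax : ℝ := deltaFun Lmax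
def rho0 : ℝ := muC ^ 4 * 1.08e-3 * 6378.14 ^ 2
def rho1 : ℝ := rhoC * rho0
def alphaCube (L : ℝ) : ℝ := L ^ 6 / (muC ^ 3 * aM ^ 3)

def aA (σ : ℝ) : ℝ := 1 - 16 * σ - 20 * σ ^ 2
def bB (σ : ℝ) : ℝ := (2 * σ + 3) * Real.sqrt (3 - 4 * σ - 4 * σ ^ 2)
def cPl (σ : ℝ) : ℝ := U00 / 2 * aA σ + 5 * U10 / 3 * bB σ
def cMi (σ : ℝ) : ℝ := U00 / 2 * aA σ - 5 * U10 / 3 * bB σ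
def Ap (σ δ : ℝ) : ℝ := aA σ + δ * cPl σ
def Am (σ δ : ℝ) : ℝ := aA σ + δ * cMi σ


/-- Unperturbed (oblateness) part of the secular Hamiltonian in Poincaré variables. -/
def H0P (ξ η Γ L : ℝ) : ℝ :=
  (rho0 / 2) * (((2*L - (ξ^2+η^2))^2 - 24*(2*L - (ξ^2+η^2))*Γ - 48*Γ^2)
    / (L^3 * (2*L - (ξ^2+η^2))^5))

def D01P (ξ η Γ L : ℝ) : ℝ :=
  (1/128) * (L^2 * (2*L - (ξ^2+η^2))^2)⁻¹ *
    ((2*L - (ξ^2+η^2))^2 - 24*(2*L - (ξ^2+η^2))*Γ - 48*Γ^2)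

def D10P (ξ η Γ L : ℝ) : ℝ :=
  (15/64) * (L^2 * (2*L - (ξ^2+η^2))^2)⁻¹ *
    Real.sqrt (2*L - (ξ^2+η^2) - 4*Γ) *
    ((6*L - 3*(ξ^2+η^2) + 4*Γ) * Real.sqrt (6*L - 3*(ξ^2+η^2) + 4*Γ)) *
    (4*L - (ξ^2+η^2))

/-- Averaged lunar perturbation in Poincaré variables. -/
def HAV1P (ξ η Γ L : ℝ) : ℝ :=
  (rho1 / L^2) *
    ((U00 / 2) * D01P ξ η Γ L *
        (8*L^2 + 12*L*(ξ^2+η^2) - 3*(ξ^2+η^2)^2)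
      + (U10 / 6) * D10P ξ η Γ L * (ξ^2 - η^2))

/-- The `h`-averaged coplanar secular Hamiltonian in Poincaré variables. -/
def HAVP (ξ η Γ L : ℝ) : ℝ := H0P ξ η Γ L + alphaCube L * HAV1P ξ η Γ L

/-- `∂²H_AV/∂ξ²` at the origin. -/
def HavXX (Γ L : ℝ) : ℝ := deriv (fun t => deriv (fun s => HAVP s 0 Γ L) t) 0
/-- `∂²H_AV/∂η²` at the origin. -/
def HavYY (Γ L : ℝ) : ℝ := deriv (fun t => deriv (fun s => HAVP 0 s Γ L) t) 0
/-- `∂²H_AV/∂ξ∂η` at the origin. -/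
def HavXY (Γ L : ℝ) : ℝ := deriv (fun t => deriv (fun s => HAVP s t Γ L) 0) 0

/-- The part of `H_AV` that depends on `M = ξ² + η²` only. -/
def radialPart (Γ L M : ℝ) : ℝ :=
  (rho0 / 2) * (((2*L - M)^2 - 24*(2*L - M)*Γ - 48*Γ^2) / (L^3 * (2*L - M)^5))
    + alphaCube L * ((rho1 / L^2) * ((U00 / 2) *
      ((1/128) * (L^2 * (2*L - M)^2)⁻¹ * ((2*L - M)^2 - 24*(2*L - M)*Γ - 48*Γ^2)) *
        (8*L^2 + 12*L*M - 3*M^2)))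

/-- The coefficient of `ξ² - η²` in `H_AV`, as a function of `M = ξ² + η²`. -/
def anisotropicPart (Γ L M : ℝ) : ℝ :=
  alphaCube L * ((rho1 / L^2) * ((U10 / 6) *
    ((15/64) * (L^2 * (2*L - M)^2)⁻¹ * Real.sqrt (2*L - M - 4*Γ) *
      ((6*L - 3*M + 4*Γ) * Real.sqrt (6*L - 3*M + 4*Γ)) * (4*L - M))))

theorem HAVP_eq (ξ η Γ L : ℝ) :
    HAVP ξ η Γ L = radialPart Γ L (ξ^2 + η^2)
      + anisotropicPart Γ L (ξ^2 + η^2) * (ξ^2 - η^2) := by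
  unfold HAVP H0P HAV1P D01P D10P radialPart anisotropicPart
  ring

theorem deriv_zero_of_even {f : ℝ → ℝ} (hf : ∀ x, f (-x) = f x) : deriv f 0 = 0 := by
  have h := deriv_comp_neg f 0
  simp only [hf, neg_zero] at h
  linarith

theorem deriv_deriv_comp_sq {φ : ℝ → ℝ} {d : ℝ} (hφ : ContDiffAt ℝ 2 φ 0)
    (hd : HasDerivAt φ d 0) :
    deriv (fun t => deriv (fun s => φ (s ^ 2)) t) 0 = 2 * d := by
  have hsq : Filter.Tendsto (fun t : ℝ => t ^ 2) (nhds 0) (nhds 0) := by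
    have : ContinuousAt (fun t : ℝ => t ^ 2) 0 := by fun_prop
    simpa [ContinuousAt] using this
  have hev : ∀ᶠ x in nhds (0 : ℝ), DifferentiableAt ℝ φ x :=
    (hφ.eventually (by simp)).mono fun x hx => hx.differentiableAt (by simp)
  have heq : (fun t => deriv (fun s => φ (s ^ 2)) t) =ᶠ[nhds 0]
      fun t => deriv φ (t ^ 2) * (2 * t) := by
    filter_upwards [hsq.eventually hev] with t ht
    have h : HasDerivAt (fun s : ℝ => s ^ 2) (2 * t) t := by
      simpa using hasDerivAt_pow 2 t
    exact (HasDerivAt.comp (h := fun s : ℝ => s ^ 2) t ht.hasDerivAt h).deriv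
  rw [heq.deriv_eq]
  have hφ' : DifferentiableAt ℝ (deriv φ) ((0 : ℝ) ^ 2) := by
    have h : ContDiffAt ℝ 1 (deriv φ) 0 := by
      have h := hφ.fderiv_right (m := 1) (by norm_num)
      exact h.clm_apply contDiffAt_const
    simpa using h.differentiableAt (by simp)
  have h1 : DifferentiableAt ℝ (fun t : ℝ => deriv φ (t ^ 2)) 0 :=
    DifferentiableAt.comp (f := fun t : ℝ => t ^ 2) 0 hφ' (by fun_prop)
  have h2 : HasDerivAt (fun t : ℝ => 2 * t) 2 0 := by
    simpa using (hasDerivAt_id (0 : ℝ)).const_mul 2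
  have h3 := (h1.hasDerivAt.mul h2).deriv
  refine h3.trans ?_
  simp [hd.deriv, mul_comm]

theorem contDiffAt_radialPart {L : ℝ} (Γ : ℝ) (hL : 0 < L) :
    ContDiffAt ℝ 2 (radialPart Γ L) 0 := by
  have h1 : L ^ 3 * (2 * L - 0) ^ 5 ≠ 0 := by simp [hL.ne']
  have h2 : L ^ 2 * (2 * L - 0) ^ 2 ≠ 0 := by simp [hL.ne']
  unfold radialPart
  fun_prop (disch := assumption)

theorem contDiffAt_anisotropicPart {L Γ : ℝ} (hL : 0 < L) (hΓ0 : 0 < Γ) (hΓL : Γ < L / 2) :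
    ContDiffAt ℝ 2 (anisotropicPart Γ L) 0 := by
  have h1 : 2 * L - 0 - 4 * Γ ≠ 0 := by linarith
  have h2 : L ^ 2 * (2 * L - 0) ^ 2 ≠ 0 := by simp [hL.ne']
  have h3 : 6 * L - 3 * 0 + 4 * Γ ≠ 0 := by linarith
  unfold anisotropicPart
  fun_prop (disch := assumption)

theorem hasDerivAt_radialPart {L : ℝ} (Γ : ℝ) (hL : 0 < L) :
    HasDerivAt (radialPart Γ L)
      (3 * rho0 / (32 * L ^ 7) * (1 + deltaFun L * (U00 / 2)) * aA (Γ / L)) 0 := by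
  have hu : HasDerivAt (fun M : ℝ => 2 * L - M) (-1) 0 := by
    simpa using (hasDerivAt_id (0 : ℝ)).const_sub (2 * L)
  have hM : HasDerivAt (fun M : ℝ => M) 1 0 := hasDerivAt_id 0
  have hN := ((hu.pow 2).sub ((hu.const_mul 24).mul_const Γ)).sub_const (48 * Γ ^ 2)
  have h1 : L ^ 3 * (2 * L - 0) ^ 5 ≠ 0 := by simp [hL.ne']
  have h2 : L ^ 2 * (2 * L - 0) ^ 2 ≠ 0 := by simp [hL.ne']
  have hP := ((hM.const_mul (12 * L)).const_add (8 * L ^ 2)).sub ((hM.pow 2).const_mul 3)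
  have hA := (hN.div ((hu.pow 5).const_mul (L ^ 3)) h1).const_mul (rho0 / 2)
  have hB := (((((((hu.pow 2).const_mul (L ^ 2)).inv h2).const_mul (1 / 128)).mul hN).const_mul
    (U00 / 2)).mul hP).const_mul (rho1 / L ^ 2) |>.const_mul (alphaCube L)
  refine (hA.add hB).congr_deriv ?_
  have : L ≠ 0 := hL.ne'
  have hmu : muC ≠ 0 := by norm_num [muC]
  have haM : aM ≠ 0 := by norm_num [aM]
  simp only [aA, deltaFun, alphaCube, rho1, Pi.pow_apply, Pi.mul_apply, Pi.sub_apply,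
    Pi.inv_apply, sub_zero]
  field_simp
  ring

theorem anisotropicPart_zero {L Γ : ℝ} (hL : 0 < L) (hΓ0 : 0 < Γ) (hΓL : Γ < L / 2) :
    anisotropicPart Γ L 0 =
      3 * rho0 / (32 * L ^ 7) * (deltaFun L * (5 * U10 / 3 * bB (Γ / L))) := by
  have hs : Real.sqrt (2 * L - 0 - 4 * Γ) * Real.sqrt (6 * L - 3 * 0 + 4 * Γ) =
      2 * L * Real.sqrt (3 - 4 * (Γ / L) - 4 * (Γ / L) ^ 2) := by
    rw [← Real.sqrt_mul (by linarith), ← Real.sqrt_sq (show (0 : ℝ) ≤ 2 * L by linarith),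
      ← Real.sqrt_mul (by positivity), Real.sqrt_sq (show (0 : ℝ) ≤ 2 * L by linarith)]
    congr 1
    field_simp
    ring
  have : L ≠ 0 := hL.ne'
  have hmu : muC ≠ 0 := by norm_num [muC]
  have haM : aM ≠ 0 := by norm_num [aM]
  calc anisotropicPart Γ L 0
      = alphaCube L * ((rho1 / L^2) * ((U10 / 6) * ((15/64) * (L^2 * (2*L)^2)⁻¹ *
          (Real.sqrt (2 * L - 0 - 4 * Γ) * Real.sqrt (6 * L - 3 * 0 + 4 * Γ)) *
            (6*L + 4*Γ) * (4*L)))) := by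
        unfold anisotropicPart
        ring
    _ = _ := by
        rw [hs]
        simp only [bB, deltaFun, alphaCube, rho1]
        field_simp
        ring

theorem deriv_deriv_radial_add {F G : ℝ → ℝ} {d : ℝ} (c : ℝ) (hF : ContDiffAt ℝ 2 F 0)
    (hG : ContDiffAt ℝ 2 G 0) (hd : HasDerivAt F d 0) :
    deriv (fun t => deriv (fun s => F (s ^ 2) + G (s ^ 2) * (c * s ^ 2)) t) 0
      = 2 * (d + c * G 0) := by
  have hc : HasDerivAt (fun x : ℝ => c * x) c 0 := by
    simpa using (hasDerivAt_id (0 : ℝ)).const_mul c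
  refine deriv_deriv_comp_sq (φ := fun x => F x + G x * (c * x)) (by fun_prop) ?_
  have hG' := (hG.differentiableAt (by simp)).hasDerivAt
  refine (hd.add (hG'.mul hc)).congr_deriv ?_
  ring

theorem HavXY_eq_zero (Γ L : ℝ) : HavXY Γ L = 0 := by
  have h (t : ℝ) : deriv (fun s => HAVP s t Γ L) 0 = 0 :=
    deriv_zero_of_even fun x => by simp only [HAVP_eq, neg_sq]
  simp [HavXY, h]

theorem HavXX_eq {L Γ : ℝ} (hL : 0 < L) (hΓ0 : 0 < Γ) (hΓL : Γ < L / 2) :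
    HavXX Γ L = (3 * rho0 / (16 * L ^ 7)) * (aA (Γ/L) + deltaFun L * cPl (Γ/L)) := by
  have h := deriv_deriv_radial_add 1 (contDiffAt_radialPart Γ hL)
    (contDiffAt_anisotropicPart hL hΓ0 hΓL) (hasDerivAt_radialPart Γ hL)
  have hfun (s : ℝ) : HAVP s 0 Γ L =
      radialPart Γ L (s ^ 2) + anisotropicPart Γ L (s ^ 2) * (1 * s ^ 2) := by
    simp [HAVP_eq]
  simp only [HavXX, hfun, h, anisotropicPart_zero hL hΓ0 hΓL, cPl]
  ring

theorem HavYY_eq {L Γ : ℝ} (hL : 0 < L) (hΓ0 : 0 < Γ) (hΓL : Γ < L / 2) :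
    HavYY Γ L = (3 * rho0 / (16 * L ^ 7)) * (aA (Γ/L) + deltaFun L * cMi (Γ/L)) := by
  have h := deriv_deriv_radial_add (-1) (contDiffAt_radialPart Γ hL)
    (contDiffAt_anisotropicPart hL hΓ0 hΓL) (hasDerivAt_radialPart Γ hL)
  have hfun (s : ℝ) : HAVP 0 s Γ L =
      radialPart Γ L (s ^ 2) + anisotropicPart Γ L (s ^ 2) * (-1 * s ^ 2) := by
    simp [HAVP_eq]
  simp only [HavYY, hfun, h, anisotropicPart_zero hL hΓ0 hΓL, cMi]
  ring

/-- the origin is a critical point of `(ξ,η) ↦ H_AV(ξ,η,Γ;L)`, the Hessian there is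
diagonal with the stated entries, and the linearization matrix
`[[−H_ξη, −H_ηη],[H_ξξ, H_ξη]]` of `ξ' = −∂H/∂η, η' = ∂H/∂ξ` has eigenvalues `±λ` with
`λ² = −(9ρ₀²/(256L¹⁴))·(𝐚(σ)+δ𝐜₊(σ))·(𝐚(σ)+δ𝐜₋(σ))`. -/
theorem stmt0 (L Γ : ℝ) (hL : 0 < L) (hΓ0 : 0 < Γ) (hΓL : Γ < L / 2) :
    deriv (fun t => HAVP t 0 Γ L) 0 = 0 ∧
    deriv (fun t => HAVP 0 t Γ L) 0 = 0 ∧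
    HavXY Γ L = 0 ∧
    HavXX Γ L = (3 * rho0 / (16 * L ^ 7)) * (aA (Γ/L) + deltaFun L * cPl (Γ/L)) ∧
    HavYY Γ L = (3 * rho0 / (16 * L ^ 7)) * (aA (Γ/L) + deltaFun L * cMi (Γ/L)) ∧
    (∀ lam : ℂ,
      Matrix.det
        ((Matrix.of ![![-(HavXY Γ L : ℂ), -(HavYY Γ L : ℂ)],
            ![(HavXX Γ L : ℂ), (HavXY Γ L : ℂ)]]) - lam • (1 : Matrix (Fin 2) (Fin 2) ℂ)) = 0
        ↔ lam ^ 2 =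
            ((-(9 * rho0 ^ 2 / (256 * L ^ 14)) *
              Ap (Γ/L) (deltaFun L) * Am (Γ/L) (deltaFun L) : ℝ) : ℂ)) := by
  refine ⟨deriv_zero_of_even fun x => by simp only [HAVP_eq, neg_sq],
    deriv_zero_of_even fun x => by simp only [HAVP_eq, neg_sq],
    HavXY_eq_zero Γ L, HavXX_eq hL hΓ0 hΓL, HavYY_eq hL hΓ0 hΓL, fun lam => ?_⟩
  have hprod : -(9 * rho0 ^ 2 / (256 * L ^ 14)) * Ap (Γ/L) (deltaFun L) * Am (Γ/L) (deltaFun L)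
      = -(HavXX Γ L * HavYY Γ L) := by
    rw [HavXX_eq hL hΓ0 hΓL, HavYY_eq hL hΓ0 hΓL, Ap, Am]
    ring
  rw [hprod, HavXY_eq_zero, Matrix.det_fin_two]
  simp only [Matrix.sub_apply, Matrix.of_apply, Matrix.smul_apply, Matrix.cons_val_zero,
    Matrix.cons_val_one, Matrix.one_apply, smul_eq_mul]
  push_cast
  constructor
  · intro h
    simp at h
    linear_combination h
  · intro h
    simp
    linear_combination h


end Secular
end
end

section
/- For each δ ∈ [0, δ_max]: (i) the function σ ↦ A₊(σ;δ) is strictly decreasing on (0, 1/2); (ii) the function σ ↦ A₋(σ;δ) is strictly decreasing on (0, m/2); (iii) there exists a unique σ₊(δ) ∈ (0, 1/2) with A₊(σ₊(δ);δ) = 0, and σ₊(δ) ∈ (m/2, 1/4) if δ > 0; (iv) there exists a unique σ₋(δ) ∈ (0, 1/2) with A₋(σ₋(δ);δ) = 0, and σ₋(δ) ∈ (0, m/2) if δ > 0; (v) σ₊(0) = σ₋(0) = m/2. -/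
noncomputable section
open Real Set

namespace Secular

lemma deltaMax_le : deltaMax ≤ 0.13 := by
  have h : Lmax ^ 10 = (muC * aMax) ^ 5 := by
    have h2 : Lmax ^ 2 = muC * aMax := Real.sq_sqrt (by norm_num [muC, aMax])
    rw [← h2]; ring
  rw [deltaMax, deltaFun, h]
  norm_num [rhoC, muC, aM, aMax]

lemma mC_half_pos : 0 < mC / 2 := by
  have : (4 : ℝ) < Real.sqrt 21 := Real.lt_sqrt_of_sq_lt (by norm_num)
  unfold mC; linarith

lemma mC_half_lt : mC / 2 < 1 / 12 := by
  have : Real.sqrt 21 < 29 / 6 := by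
    rw [Real.sqrt_lt' (by norm_num)]; norm_num
  unfold mC; linarith

lemma aA_mC_half : aA (mC / 2) = 0 := by
  have : Real.sqrt 21 ^ 2 = 21 := Real.sq_sqrt (by norm_num)
  unfold aA mC; nlinarith

lemma aA_lt_aA {x y : ℝ} (hx : 0 ≤ x) (hxy : x < y) : aA y < aA x := by
  unfold aA; nlinarith

lemma bB_nonneg {x : ℝ} (hx : 0 ≤ x) : 0 ≤ bB x := by
  unfold bB; positivity

lemma bB_pos {x : ℝ} (hx : 0 ≤ x) (hx' : x < 1 / 2) : 0 < bB x := by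
  have : 0 < 3 - 4 * x - 4 * x ^ 2 := by nlinarith
  unfold bB; positivity

lemma bB_sq {x : ℝ} (hx : 0 ≤ x) (hx' : x ≤ 1 / 2) :
    bB x ^ 2 = (2 * x + 3) ^ 3 * (1 - 2 * x) := by
  have : 0 ≤ 3 - 4 * x - 4 * x ^ 2 := by nlinarith
  rw [bB, mul_pow, Real.sq_sqrt this]; ring

lemma bB_sq_sub_bB_sq {x y : ℝ} (hx : 0 ≤ x) (hx' : x ≤ 1 / 2) (hy : 0 ≤ y) (hy' : y ≤ 1 / 2) :
    bB x ^ 2 - bB y ^ 2 =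
      (y - x) * (72 * (x + y) + 64 * (x ^ 2 + x * y + y ^ 2) + 16 * (x + y) * (x ^ 2 + y ^ 2)) := by
  rw [bB_sq hx hx', bB_sq hy hy']; ring

lemma bB_le_bB {x y : ℝ} (hx : 0 ≤ x) (hxy : x ≤ y) (hy : y ≤ 1 / 2) : bB y ≤ bB x := by
  have hy0 := hx.trans hxy
  refine le_of_sq_le_sq ?_ (bB_nonneg hx)
  have h := bB_sq_sub_bB_sq hx (hxy.trans hy) hy0 hy
  have : 0 ≤ (y - x) * (72 * (x + y) + 64 * (x ^ 2 + x * y + y ^ 2) +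
      16 * (x + y) * (x ^ 2 + y ^ 2)) :=
    mul_nonneg (sub_nonneg.2 hxy) (by positivity)
  linarith

lemma three_le_bB {x : ℝ} (hx : 0 ≤ x) (hx' : x ≤ 1 / 12) : 3 ≤ bB x := by
  have : 1 ≤ Real.sqrt (3 - 4 * x - 4 * x ^ 2) := Real.one_le_sqrt.2 (by nlinarith)
  unfold bB; nlinarith

lemma bB_sub_bB_le {x y : ℝ} (hx : 0 ≤ x) (hxy : x ≤ y) (hy : y ≤ 1 / 12) :
    bB x - bB y ≤ 10 * (y - x) := by
  have hy0 := hx.trans hxy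
  have h := bB_sq_sub_bB_sq hx (by linarith) hy0 (by linarith)
  have hbx := three_le_bB hx (hxy.trans hy)
  have hby := three_le_bB hy0 hy
  have hb := bB_le_bB hx hxy (by linarith)
  have hQ : 72 * (x + y) + 64 * (x ^ 2 + x * y + y ^ 2) + 16 * (x + y) * (x ^ 2 + y ^ 2) ≤ 60 := by
    have h1 : x ≤ 1 / 12 := hxy.trans hy
    have h2 : x ^ 2 ≤ 1 / 12 := by nlinarith
    have h3 : y ^ 2 ≤ 1 / 12 := by nlinarith
    have h4 : x * y ≤ 1 / 12 := by nlinarith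
    have h5 : (x + y) * (x ^ 2 + y ^ 2) ≤ 1 / 6 * (1 / 6) :=
      mul_le_mul (by linarith) (by linarith) (by positivity) (by norm_num)
    linarith
  have h1 := mul_le_mul_of_nonneg_left hQ (sub_nonneg.2 hxy)
  have h2 : 6 * (bB x - bB y) ≤ bB x ^ 2 - bB y ^ 2 := by nlinarith
  linarith

lemma Ap_strictAntiOn {δ : ℝ} (hδ : 0 ≤ δ) :
    StrictAntiOn (fun σ => Ap σ δ) (Set.Icc 0 (1 / 2)) := by
  intro x hx y hy hxy
  have ha := aA_lt_aA hx.1 hxy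
  have hb := bB_le_bB hx.1 hxy.le hy.2
  have hc : cPl y ≤ cPl x := by unfold cPl U00 U10; linarith
  have := mul_le_mul_of_nonneg_left hc hδ
  simp only [Ap]; linarith

lemma Am_strictAntiOn {δ : ℝ} (hδ : 0 ≤ δ) (hδ' : δ ≤ 0.13) :
    StrictAntiOn (fun σ => Am σ δ) (Set.Icc 0 (1 / 12)) := by
  intro x hx y hy hxy
  have ha : 16 * (y - x) ≤ aA x - aA y := by
    have := hx.1
    unfold aA; nlinarith
  have hb := bB_sub_bB_le hx.1 hxy.le hy.2
  have hc : cMi y - cMi x ≤ 10 * (y - x) := by unfold cMi U00 U10; linarith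
  have h1 := mul_le_mul_of_nonneg_left hc hδ
  have h2 : δ * (10 * (y - x)) ≤ 0.13 * (10 * (y - x)) :=
    mul_le_mul_of_nonneg_right hδ' (by linarith)
  simp only [Am]; linarith

lemma Ap_mC_half (δ : ℝ) : Ap (mC / 2) δ = δ * (5 * U10 / 3 * bB (mC / 2)) := by
  simp [Ap, cPl, aA_mC_half]

lemma Am_mC_half (δ : ℝ) : Am (mC / 2) δ = -(δ * (5 * U10 / 3 * bB (mC / 2))) := by
  simp [Am, cMi, aA_mC_half]

lemma bB_zero_le : bB 0 ≤ 6 := by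
  have : Real.sqrt 3 ≤ 2 := Real.sqrt_le_iff.2 (by norm_num)
  norm_num [bB]; linarith

lemma Ap_quarter_neg {δ : ℝ} (hδ : 0 ≤ δ) (hδ' : δ ≤ 0.13) : Ap (1 / 4) δ < 0 := by
  have hb := (bB_le_bB le_rfl (by norm_num) (by norm_num) : bB (1 / 4) ≤ bB 0).trans bB_zero_le
  have hc : cPl (1 / 4) ≤ 6 := by norm_num [cPl, aA, U00, U10]; linarith
  have ha : aA (1 / 4) = -4.25 := by norm_num [aA]
  have := mul_le_mul_of_nonneg_left hc hδ
  rw [Ap, ha]; linarith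

lemma Am_zero_pos {δ : ℝ} (hδ : 0 ≤ δ) (hδ' : δ ≤ 0.13) : 0 < Am 0 δ := by
  have hb := bB_zero_le
  have hc : -6 ≤ cMi 0 := by norm_num [cMi, aA, U00, U10]; linarith
  have ha : aA 0 = 1 := by norm_num [aA]
  have := mul_le_mul_of_nonneg_left hc hδ
  rw [Am, ha]; linarith

lemma Am_neg {δ σ : ℝ} (hδ : 0 < δ) (hσ : mC / 2 ≤ σ) (hσ' : σ < 1 / 2) : Am σ δ < 0 := by
  have h0 := mC_half_pos
  have hb := bB_pos (h0.le.trans hσ) hσ'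
  have ha : aA σ ≤ 0 := by
    rcases hσ.eq_or_lt with h | h
    · rw [← h, aA_mC_half]
    · exact (aA_mC_half ▸ aA_lt_aA h0.le h).le
  have hc : cMi σ < 0 := by unfold cMi U00 U10; linarith
  have := mul_neg_of_pos_of_neg hδ hc
  unfold Am; linarith

lemma continuous_Ap (δ : ℝ) : Continuous fun σ => Ap σ δ := by
  unfold Ap cPl aA bB; fun_prop

lemma continuous_Am (δ : ℝ) : Continuous fun σ => Am σ δ := by
  unfold Am cMi aA bB; fun_prop

/-- For each `δ ∈ [0, δ_max]`, `A₊(·;δ)` is strictly decreasing on `(0,1/2)`,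
`A₋(·;δ)` is strictly decreasing on `(0,m/2)`, each of them has a unique zero in `(0,1/2)`,
located in `(m/2,1/4)` resp. `(0,m/2)` when `δ > 0`, and at `δ = 0` both zeros equal `m/2`. -/
theorem stmt1 :
    ∀ δ ∈ Set.Icc (0:ℝ) deltaMax,
      StrictAntiOn (fun σ => Ap σ δ) (Set.Ioo 0 (1/2)) ∧
      StrictAntiOn (fun σ => Am σ δ) (Set.Ioo 0 (mC / 2)) ∧
      (∃ σp, (σp ∈ Set.Ioo (0:ℝ) (1/2) ∧ Ap σp δ = 0) ∧
        (∀ σ' ∈ Set.Ioo (0:ℝ) (1/2), Ap σ' δ = 0 → σ' = σp) ∧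
        (0 < δ → σp ∈ Set.Ioo (mC / 2) (1/4))) ∧
      (∃ σm, (σm ∈ Set.Ioo (0:ℝ) (1/2) ∧ Am σm δ = 0) ∧
        (∀ σ' ∈ Set.Ioo (0:ℝ) (1/2), Am σ' δ = 0 → σ' = σm) ∧
        (0 < δ → σm ∈ Set.Ioo 0 (mC / 2))) ∧
      (Ap (mC / 2) 0 = 0 ∧ Am (mC / 2) 0 = 0) := by
  rintro δ ⟨hδ, hδm⟩
  have hδ' : δ ≤ 0.13 := hδm.trans deltaMax_le
  have hm0 := mC_half_pos
  have hm1 := mC_half_lt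
  have hp := (Ap_strictAntiOn hδ).mono Ioo_subset_Icc_self
  have hn := (Am_strictAntiOn hδ hδ').mono
    (Ioo_subset_Icc_self.trans (Icc_subset_Icc_right hm1.le))
  have hmem : mC / 2 ∈ Set.Ioo (0 : ℝ) (1 / 2) := ⟨hm0, by linarith⟩
  have hm : Ap (mC / 2) 0 = 0 ∧ Am (mC / 2) 0 = 0 := by simp [Ap_mC_half, Am_mC_half]
  refine ⟨hp, hn, ?_, ?_, hm⟩
  · have key : ∃ σ ∈ Set.Ioo (0 : ℝ) (1 / 2), Ap σ δ = 0 ∧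
        (0 < δ → σ ∈ Set.Ioo (mC / 2) (1 / 4)) := by
      rcases hδ.eq_or_lt with rfl | hpos
      · exact ⟨mC / 2, hmem, hm.1, fun h => absurd h (lt_irrefl _)⟩
      · have h1 : 0 < Ap (mC / 2) δ := by
          have := bB_pos hmem.1.le hmem.2
          rw [Ap_mC_half]; unfold U10; positivity
        obtain ⟨σ, hσ, h0⟩ := intermediate_value_Ioo' (by linarith : mC / 2 ≤ 1 / 4)
          (continuous_Ap δ).continuousOn ⟨Ap_quarter_neg hδ hδ', h1⟩
        exact ⟨σ, ⟨hm0.trans hσ.1, by linarith [hσ.2]⟩, h0, fun _ => hσ⟩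
    obtain ⟨σ, hσ, h0, hloc⟩ := key
    exact ⟨σ, ⟨hσ, h0⟩, fun σ' hσ' h' => hp.injOn hσ' hσ (h'.trans h0.symm), hloc⟩
  · rcases hδ.eq_or_lt with rfl | hpos
    · refine ⟨mC / 2, ⟨hmem, hm.2⟩, fun σ' hσ' h' => ?_, fun h => absurd h (lt_irrefl _)⟩
      refine hp.injOn hσ' hmem ?_
      have : Ap σ' 0 = Am σ' 0 := by simp [Ap, Am]
      exact this.trans (h'.trans hm.1.symm)
    · have h1 : Am (mC / 2) δ < 0 := Am_neg hpos le_rfl hmem.2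
      obtain ⟨σ, hσ, h0⟩ := intermediate_value_Ioo' hm0.le
        (continuous_Am δ).continuousOn ⟨h1, Am_zero_pos hδ hδ'⟩
      refine ⟨σ, ⟨⟨hσ.1, hσ.2.trans hmem.2⟩, h0⟩, fun σ' hσ' h' => ?_, fun _ => hσ⟩
      have hlt : σ' < mC / 2 := by
        by_contra! h
        exact (Am_neg hpos h hσ'.2).ne h'
      exact hn.injOn ⟨hσ'.1, hlt⟩ hσ (h'.trans h0.symm)

end Secular
end
end

section
/- The functions a(s) = 5s² + 8s − 1, b₊(s), b₋(s), c₊(s), c₋(s) are all strictly increasing on [0, 1/2]. Moreover a(m) = 0, a(s) < 0 for s ∈ [0, m), and a(s) > 0 for s ∈ (m, 1/2]. Consequently, for every ŷ > 0 and δ > 0, the function s ↦ G₊(s,ŷ;δ) and the function s ↦ G₋(s,ŷ;δ) are strictly increasing on [0, 1/2]. -/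
noncomputable section
open Real Set

namespace Secular

/-- `a(s) = 5s² + 8s − 1`. -/
def aE (s : ℝ) : ℝ := 5 * s ^ 2 + 8 * s - 1
def bEp (s : ℝ) : ℝ :=
  10 * U00 * s * (1 + s) + 20 * U10 * (3 + s) * s ^ 2 / (3 * Real.sqrt (3 - 2*s - s^2))
def bEm (s : ℝ) : ℝ :=
  10 * U00 * s * (1 + s) - 20 * U10 * (3 + s) * s ^ 2 / (3 * Real.sqrt (3 - 2*s - s^2))
def cEp (s : ℝ) : ℝ :=
  8 * U00 * (3*s - 1) + 20 * U10 * (3 + s) * (8*s - 12) / (3 * Real.sqrt (3 - 2*s - s^2))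
def cEm (s : ℝ) : ℝ :=
  8 * U00 * (3*s - 1) - 20 * U10 * (3 + s) * (8*s - 12) / (3 * Real.sqrt (3 - 2*s - s^2))
def Gp (s yh δ : ℝ) : ℝ := aE s + 2 * δ * (bEp s * yh ^ 3 + cEp s * yh ^ 5)
def Gm (s yh δ : ℝ) : ℝ := aE s + 2 * δ * (bEm s * yh ^ 3 + cEm s * yh ^ 5)

/-- The common factor `(3 + s) / √(3 - 2s - s²)` of `b₊`, `b₋`, `c₊`, `c₋`. -/
def sqrtFactor (s : ℝ) : ℝ := (3 + s) / Real.sqrt (3 - 2 * s - s ^ 2)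

lemma seven_fourths_le_radicand {s : ℝ} (hs : s ∈ Set.Icc (0 : ℝ) (1 / 2)) :
    7 / 4 ≤ 3 - 2 * s - s ^ 2 := by
  obtain ⟨h0, h1⟩ := hs
  nlinarith

lemma sqrtFactor_pos {s : ℝ} (hs : s ∈ Set.Icc (0 : ℝ) (1 / 2)) : 0 < sqrtFactor s := by
  have hw := seven_fourths_le_radicand hs
  have hs0 := hs.1
  have : 0 < Real.sqrt (3 - 2 * s - s ^ 2) := Real.sqrt_pos.2 (by linarith)
  unfold sqrtFactor
  positivity

lemma sqrtFactor_le {s : ℝ} (hs : s ∈ Set.Icc (0 : ℝ) (1 / 2)) : sqrtFactor s ≤ 2.65 := by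
  have hw := seven_fourths_le_radicand hs
  obtain ⟨h0, h1⟩ := hs
  have hpos : 0 < Real.sqrt (3 - 2 * s - s ^ 2) := Real.sqrt_pos.2 (by linarith)
  unfold sqrtFactor
  rw [div_le_iff₀ hpos]
  refine le_of_sq_le_sq ?_ (by positivity)
  rw [mul_pow, Real.sq_sqrt (by linarith)]
  nlinarith

lemma hasDerivAt_sqrtFactor {s : ℝ} (hs : s ∈ Set.Icc (0 : ℝ) (1 / 2)) :
    HasDerivAt sqrtFactor (2 * (sqrtFactor s / (3 - 2 * s - s ^ 2))) s := by
  have hw := seven_fourths_le_radicand hs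
  have hw0 : 3 - 2 * s - s ^ 2 ≠ 0 := by linarith
  have hpos : 0 < Real.sqrt (3 - 2 * s - s ^ 2) := Real.sqrt_pos.2 (by linarith)
  have hsq : Real.sqrt (3 - 2 * s - s ^ 2) ^ 2 = 3 - 2 * s - s ^ 2 :=
    Real.sq_sqrt (by linarith)
  have hrad : HasDerivAt (fun x : ℝ => 3 - 2 * x - x ^ 2) (-2 - 2 * s) s := by
    refine ((((hasDerivAt_id s).const_mul 2).const_sub 3).sub (hasDerivAt_pow 2 s)).congr_deriv ?_
    norm_num
  refine (((hasDerivAt_id s).const_add 3).div (hrad.sqrt hw0) hpos.ne').congr_deriv ?_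
  unfold sqrtFactor
  rw [hsq, id_eq]
  field_simp
  rw [hsq]
  ring

lemma sqrtFactor_div_radicand_mem {s : ℝ} (hs : s ∈ Set.Icc (0 : ℝ) (1 / 2)) :
    sqrtFactor s / (3 - 2 * s - s ^ 2) ∈ Set.Icc (0 : ℝ) 1.52 := by
  have hw := seven_fourths_le_radicand hs
  have hr := sqrtFactor_le hs
  have hr0 := sqrtFactor_pos hs
  refine ⟨div_nonneg hr0.le (by linarith), ?_⟩
  rw [div_le_iff₀ (by linarith)]
  linarith

lemma hasDerivAt_sq_mul_sqrtFactor {s : ℝ} (hs : s ∈ Set.Icc (0 : ℝ) (1 / 2)) :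
    HasDerivAt (fun x => x ^ 2 * sqrtFactor x)
      (2 * s * sqrtFactor s + 2 * s ^ 2 * (sqrtFactor s / (3 - 2 * s - s ^ 2))) s := by
  refine ((hasDerivAt_pow 2 s).mul (hasDerivAt_sqrtFactor hs)).congr_deriv ?_
  norm_num
  ring

lemma hasDerivAt_affine_mul_sqrtFactor {s : ℝ} (hs : s ∈ Set.Icc (0 : ℝ) (1 / 2)) :
    HasDerivAt (fun x => (8 * x - 12) * sqrtFactor x)
      (-8 * s ^ 2 * (sqrtFactor s / (3 - 2 * s - s ^ 2))) s := by
  have hw := seven_fourths_le_radicand hs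
  have hdiv := div_mul_cancel₀ (sqrtFactor s) (by linarith : 3 - 2 * s - s ^ 2 ≠ 0)
  refine ((((hasDerivAt_id s).const_mul 8).sub_const 12).mul
    (hasDerivAt_sqrtFactor hs)).congr_deriv ?_
  simp only [id_eq]
  linear_combination -8 * hdiv

lemma hasDerivAt_quadratic (s : ℝ) :
    HasDerivAt (fun x : ℝ => 10 * U00 * x * (1 + x)) (10 * U00 * (1 + 2 * s)) s := by
  refine (((hasDerivAt_id s).const_mul (10 * U00)).mul
    ((hasDerivAt_id s).const_add 1)).congr_deriv ?_
  simp only [id_eq]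
  ring

lemma hasDerivAt_affine (s : ℝ) :
    HasDerivAt (fun x : ℝ => 8 * U00 * (3 * x - 1)) (8 * U00 * 3) s := by
  refine ((((hasDerivAt_id s).const_mul 3).sub_const 1).const_mul (8 * U00)).congr_deriv ?_
  ring

lemma strictMonoOn_Icc_of_hasDerivAt_pos {f f' : ℝ → ℝ} {a b : ℝ}
    (hf : ∀ x ∈ Set.Icc a b, HasDerivAt f (f' x) x) (hpos : ∀ x ∈ Set.Icc a b, 0 < f' x) :
    StrictMonoOn f (Set.Icc a b) := by
  refine strictMonoOn_of_deriv_pos (convex_Icc a b)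
    (fun x hx => (hf x hx).continuousAt.continuousWithinAt) fun x hx => ?_
  rw [(hf x (interior_subset hx)).deriv]
  exact hpos x (interior_subset hx)

lemma strictMonoOn_aE : StrictMonoOn aE (Set.Ici 0) := by
  intro x hx y _ hxy
  have hx0 : 0 ≤ x := hx
  unfold aE
  nlinarith

lemma bEp_eq : bEp = fun x => 10 * U00 * x * (1 + x) + 20 * U10 / 3 * (x ^ 2 * sqrtFactor x) := by
  funext x
  unfold bEp sqrtFactor
  ring

lemma bEm_eq : bEm = fun x => 10 * U00 * x * (1 + x) - 20 * U10 / 3 * (x ^ 2 * sqrtFactor x) := by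
  funext x
  unfold bEm sqrtFactor
  ring

lemma cEp_eq :
    cEp = fun x => 8 * U00 * (3 * x - 1) + 20 * U10 / 3 * ((8 * x - 12) * sqrtFactor x) := by
  funext x
  unfold cEp sqrtFactor
  ring

lemma cEm_eq :
    cEm = fun x => 8 * U00 * (3 * x - 1) - 20 * U10 / 3 * ((8 * x - 12) * sqrtFactor x) := by
  funext x
  unfold cEm sqrtFactor
  ring

lemma strictMonoOn_bEp : StrictMonoOn bEp (Set.Icc 0 (1 / 2)) := by
  rw [bEp_eq]
  refine strictMonoOn_Icc_of_hasDerivAt_pos (fun x hx => (hasDerivAt_quadratic x).add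
    ((hasDerivAt_sq_mul_sqrtFactor hx).const_mul _)) fun x hx => ?_
  have hq := (sqrtFactor_div_radicand_mem hx).1
  have hr := sqrtFactor_pos hx
  have hx0 := hx.1
  unfold U00 U10
  positivity

lemma strictMonoOn_bEm : StrictMonoOn bEm (Set.Icc 0 (1 / 2)) := by
  rw [bEm_eq]
  refine strictMonoOn_Icc_of_hasDerivAt_pos (fun x hx => (hasDerivAt_quadratic x).sub
    ((hasDerivAt_sq_mul_sqrtFactor hx).const_mul _)) fun x hx => ?_
  have hq := mul_le_mul_of_nonneg_left (sqrtFactor_div_radicand_mem hx).2 (sq_nonneg x)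
  have hr := mul_le_mul_of_nonneg_left (sqrtFactor_le hx) hx.1
  obtain ⟨h0, h1⟩ := hx
  norm_num only [U00, U10] at *
  nlinarith

lemma strictMonoOn_cEp : StrictMonoOn cEp (Set.Icc 0 (1 / 2)) := by
  rw [cEp_eq]
  refine strictMonoOn_Icc_of_hasDerivAt_pos (fun x hx => (hasDerivAt_affine x).add
    ((hasDerivAt_affine_mul_sqrtFactor hx).const_mul _)) fun x hx => ?_
  have hq := mul_le_mul_of_nonneg_left (sqrtFactor_div_radicand_mem hx).2 (sq_nonneg x)
  obtain ⟨h0, h1⟩ := hx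
  norm_num only [U00, U10] at *
  nlinarith

lemma strictMonoOn_cEm : StrictMonoOn cEm (Set.Icc 0 (1 / 2)) := by
  rw [cEm_eq]
  refine strictMonoOn_Icc_of_hasDerivAt_pos (fun x hx => (hasDerivAt_affine x).sub
    ((hasDerivAt_affine_mul_sqrtFactor hx).const_mul _)) fun x hx => ?_
  have hq := mul_nonneg (sq_nonneg x) (sqrtFactor_div_radicand_mem hx).1
  norm_num only [U00, U10] at *
  nlinarith

lemma aE_mC : aE mC = 0 := by
  have h : Real.sqrt 21 ^ 2 = 21 := Real.sq_sqrt (by norm_num)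
  unfold aE mC
  linear_combination h / 5

lemma mC_nonneg : 0 ≤ mC := by
  have h : 4 ≤ Real.sqrt 21 := Real.le_sqrt_of_sq_le (by norm_num)
  unfold mC
  linarith

lemma strictMonoOn_add_mul {a b c : ℝ → ℝ} {t : Set ℝ} (ha : StrictMonoOn a t)
    (hb : StrictMonoOn b t) (hc : StrictMonoOn c t) {y δ : ℝ} (hy : 0 < y) (hδ : 0 < δ) :
    StrictMonoOn (fun s => a s + 2 * δ * (b s * y ^ 3 + c s * y ^ 5)) t := by
  intro u hu v hv huv
  have h1 := ha hu hv huv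
  have h2 := hb hu hv huv
  have h3 := hc hu hv huv
  dsimp only
  gcongr

/-- `a`, `b₊`, `b₋`, `c₊`, `c₋` are strictly increasing on `[0,1/2]`; `a(m) = 0`
with the stated signs; consequently `G₊(·,ŷ;δ)` and `G₋(·,ŷ;δ)` are strictly increasing on
`[0,1/2]` for every `ŷ > 0`, `δ > 0`. -/
theorem stmt4 :
    StrictMonoOn aE (Set.Icc 0 (1/2)) ∧
    StrictMonoOn bEp (Set.Icc 0 (1/2)) ∧
    StrictMonoOn bEm (Set.Icc 0 (1/2)) ∧
    StrictMonoOn cEp (Set.Icc 0 (1/2)) ∧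
    StrictMonoOn cEm (Set.Icc 0 (1/2)) ∧
    aE mC = 0 ∧
    (∀ s ∈ Set.Ico (0:ℝ) mC, aE s < 0) ∧
    (∀ s ∈ Set.Ioc mC (1/2), 0 < aE s) ∧
    (∀ yh δ : ℝ, 0 < yh → 0 < δ →
      StrictMonoOn (fun s => Gp s yh δ) (Set.Icc 0 (1/2)) ∧
      StrictMonoOn (fun s => Gm s yh δ) (Set.Icc 0 (1/2))) := by
  have ha : StrictMonoOn aE (Set.Icc 0 (1 / 2)) := strictMonoOn_aE.mono Set.Icc_subset_Ici_self
  refine ⟨ha, strictMonoOn_bEp, strictMonoOn_bEm, strictMonoOn_cEp, strictMonoOn_cEm, aE_mC,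
    fun s hs => ?_, fun s hs => ?_, fun y δ hy hδ =>
    ⟨strictMonoOn_add_mul ha strictMonoOn_bEp strictMonoOn_cEp hy hδ,
      strictMonoOn_add_mul ha strictMonoOn_bEm strictMonoOn_cEm hy hδ⟩⟩
  · exact aE_mC ▸ strictMonoOn_aE hs.1 mC_nonneg hs.2
  · exact aE_mC ▸ strictMonoOn_aE mC_nonneg (mC_nonneg.trans hs.1.le) hs.1

end Secular
end
end

section
/- There exists C* > 0 such that for every δ ∈ (0, δ_max], every Γ̂_CP ∈ [0, 0.49] and every Γ̂_AV ∈ [0, 1/2) satisfying Ĥ_CP(Γ̂_CP, 0; δ) = Ĥ_AV(Γ̂_AV; δ), one has |Γ̂_AV − Γ̂_CP − δ·ĉ₀(Γ̂_CP; δ)| ≤ C*·δ². -/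
noncomputable section
open Real Set

namespace Secular

/-- Rescaled coplanar secular Hamiltonian at circular motions `ξ = η = 0`. -/
def HCPhat (Γh h δ : ℝ) : ℝ :=
  (1 - 12*Γh - 12*Γh^2) * (1 + δ * U00 / 2)
  - 2 * δ * U10 * (2*Γh + 1) * Real.sqrt ((1 - 2*Γh) * (3 + 2*Γh)) * Real.cos h
  - (δ * U20 / 2) * (1 - 2*Γh) * (3 + 2*Γh) * Real.cos (2*h)

/-- Rescaled averaged Hamiltonian at circular motions. -/
def HAVhat (Γh δ : ℝ) : ℝ := (1 - 12*Γh - 12*Γh^2) * (1 + δ * U00 / 2)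

def a0hat (σ δ : ℝ) : ℝ := -(1 + 2*σ) * (1 + δ * U00 / 2)

def c0hat (σ δ : ℝ) : ℝ :=
  -(4 * U10 * Real.sqrt ((1 - 2*σ) * (3 + 2*σ)) * (2*σ + 1)
      + U20 * (1 - 2*σ) * (3 + 2*σ)) / (24 * a0hat σ δ)

/-- First-order expansion of the solution `y` of `(y - x) (1 + x + y) = e`, with quadratic error. -/
theorem abs_sub_sub_div_le {x y e : ℝ} (hx : 0 ≤ x) (hy : 0 ≤ y) (he : 0 ≤ e)
    (h : (y - x) * (1 + x + y) = e) : |y - x - e / (1 + 2 * x)| ≤ e ^ 2 := by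
  have hx' : 0 < 1 + 2 * x := by positivity
  have hd : 0 ≤ y - x := by
    by_contra! hneg
    nlinarith [mul_pos (neg_pos.2 hneg) (by positivity : 0 < 1 + x + y)]
  have hde : y - x ≤ e := by nlinarith [mul_nonneg hd (add_nonneg hx hy)]
  have key : y - x - e / (1 + 2 * x) = -((y - x) ^ 2 / (1 + 2 * x)) := by
    rw [← h]
    field_simp
    ring
  rw [key, abs_neg, abs_of_nonneg (by positivity)]
  calc (y - x) ^ 2 / (1 + 2 * x) ≤ (y - x) ^ 2 := div_le_self (sq_nonneg _) (by linarith)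
    _ ≤ e ^ 2 := pow_le_pow_left₀ hd hde 2

/-- uniform first-order relation between the `Γ̂`-values of the coplanar and
averaged Hamiltonians on the same energy level. -/
theorem stmt12 :
    ∃ Cstar > (0:ℝ),
      ∀ δ ∈ Set.Ioc (0:ℝ) deltaMax,
        ∀ ΓCP ∈ Set.Icc (0:ℝ) 0.49, ∀ ΓAV ∈ Set.Ico (0:ℝ) (1/2),
          HCPhat ΓCP 0 δ = HAVhat ΓAV δ →
            |ΓAV - ΓCP - δ * c0hat ΓCP δ| ≤ Cstar * δ ^ 2 := by
  refine ⟨1, one_pos, fun δ hδ x hx y hy h => ?_⟩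
  obtain ⟨hδ, -⟩ := hδ
  obtain ⟨hx0, hx1⟩ := hx
  have hx2 : x ≤ 1 / 2 := hx1.trans (by norm_num)
  simp only [HCPhat, HAVhat, mul_zero, Real.cos_zero, mul_one] at h
  have hP0 : 0 ≤ (1 - 2 * x) * (3 + 2 * x) :=
    mul_nonneg (by linarith) (by linarith)
  have hP4 : (1 - 2 * x) * (3 + 2 * x) ≤ 4 := by nlinarith
  have hS0 := Real.sqrt_nonneg ((1 - 2 * x) * (3 + 2 * x))
  have hS2 : Real.sqrt ((1 - 2 * x) * (3 + 2 * x)) ≤ 2 :=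
    Real.sqrt_le_iff.2 ⟨by norm_num, by linarith⟩
  have hc : c0hat x δ = (4 * U10 * Real.sqrt ((1 - 2 * x) * (3 + 2 * x)) * (2 * x + 1)
      + U20 * (1 - 2 * x) * (3 + 2 * x)) / (24 * ((1 + 2 * x) * (1 + δ * U00 / 2))) := by
    rw [c0hat, a0hat, neg_mul, mul_neg, neg_div_neg_eq]
  rw [hc]
  generalize Real.sqrt ((1 - 2 * x) * (3 + 2 * x)) = S at *
  have hST0 : 0 ≤ S * (2 * x + 1) := mul_nonneg hS0 (by linarith)
  have hST4 : S * (2 * x + 1) ≤ 4 := by nlinarith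
  have hK : 1 ≤ 1 + δ * U00 / 2 := by
    unfold U00
    linarith
  generalize 1 + δ * U00 / 2 = K at *
  have hN0 : 0 ≤ 4 * U10 * S * (2 * x + 1) + U20 * (1 - 2 * x) * (3 + 2 * x) := by
    unfold U10 U20
    linarith
  have hN : 4 * U10 * S * (2 * x + 1) + U20 * (1 - 2 * x) * (3 + 2 * x) ≤ 24 := by
    unfold U10 U20
    linarith
  have hNh : 24 * K * ((y - x) * (1 + x + y)) =
      δ * (4 * U10 * S * (2 * x + 1) + U20 * (1 - 2 * x) * (3 + 2 * x)) := by
    linear_combination 2 * h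
  generalize 4 * U10 * S * (2 * x + 1) + U20 * (1 - 2 * x) * (3 + 2 * x) = N at *
  have hK0 : 0 < K := by linarith
  have he0 : 0 ≤ δ * N / (24 * K) := by positivity
  have heδ : δ * N / (24 * K) ≤ δ := by
    rw [div_le_iff₀ (by positivity)]
    exact mul_le_mul_of_nonneg_left (by linarith) hδ.le
  have he : (y - x) * (1 + x + y) = δ * N / (24 * K) := by
    rw [eq_div_iff (by positivity), ← hNh]
    ring
  have hx' : 1 + 2 * x ≠ 0 := by positivity
  have hce : δ * (N / (24 * ((1 + 2 * x) * K))) = δ * N / (24 * K) / (1 + 2 * x) := by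
    field_simp
  rw [hce, one_mul]
  exact (abs_sub_sub_div_le hx0 hy.1 he0 he).trans (pow_le_pow_left₀ he0 heδ 2)

end Secular
end
end

section
/- For all Γ̂ ∈ [0, 0.49]: U10·(2Γ̂+1) > U20·√((1−2Γ̂)(3+2Γ̂)). Consequently, for every δ > 0 and every solution (Γ̂(s), ĥ(s)) of the rescaled coplanar system with Γ̂(s) ∈ [0, 0.49], one has Γ̂'(s) = 0 if and only if sin ĥ(s) = 0. -/
noncomputable section
open Real Set

namespace Secular

/-- RHS of `ĥ'` in the rescaled coplanar system. -/
def Fh (Γh h δ : ℝ) : ℝ :=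
  -(1 + 2*Γh) * (1 + δ * U00 / 2)
  - (2*δ/3) * U10 * (1 - 4*Γh - 4*Γh^2) / Real.sqrt ((1 - 2*Γh) * (3 + 2*Γh)) * Real.cos h
  + (δ/6) * U20 * (1 + 2*Γh) * Real.cos (2*h)

/-- RHS of `Γ̂'` in the rescaled coplanar system. -/
def FΓ (Γh h δ : ℝ) : ℝ :=
  -(δ/12) * (2 * U10 * Real.sqrt ((1 - 2*Γh) * (3 + 2*Γh)) * (2*Γh + 1) * Real.sin h
    + U20 * (1 - 2*Γh) * (3 + 2*Γh) * Real.sin (2*h))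

/-- `(Γ̂, ĥ)` solves the rescaled coplanar system on `ℝ`. -/
def SolvesCP (Γh hh : ℝ → ℝ) (δ : ℝ) : Prop :=
  ∀ t : ℝ, HasDerivAt Γh (FΓ (Γh t) (hh t) δ) t ∧ HasDerivAt hh (Fh (Γh t) (hh t) δ) t

theorem U20_mul_sqrt_lt {Γh : ℝ} (hΓ : Γh ∈ Set.Icc (0:ℝ) 0.49) :
    U20 * Real.sqrt ((1 - 2*Γh) * (3 + 2*Γh)) < U10 * (2*Γh + 1) := by
  obtain ⟨h0, -⟩ := hΓ
  have hsqrt : Real.sqrt ((1 - 2*Γh) * (3 + 2*Γh)) ≤ 2 :=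
    Real.sqrt_le_iff.mpr ⟨by norm_num, by nlinarith⟩
  unfold U20 U10
  linarith

theorem FΓ_eq_mul {Γh : ℝ} (hΓ : 0 ≤ (1 - 2*Γh) * (3 + 2*Γh)) (h δ : ℝ) :
    FΓ Γh h δ = -(δ/6) * Real.sqrt ((1 - 2*Γh) * (3 + 2*Γh)) *
      (U10 * (2*Γh + 1) + U20 * Real.sqrt ((1 - 2*Γh) * (3 + 2*Γh)) * Real.cos h) *
      Real.sin h := by
  rw [FΓ, Real.sin_two_mul]
  linear_combination (δ/6) * U20 * Real.sin h * Real.cos h * Real.sq_sqrt hΓ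

theorem FΓ_eq_zero_iff {Γh h δ : ℝ} (hδ : 0 < δ) (hΓ : Γh ∈ Set.Icc (0:ℝ) 0.49) :
    FΓ Γh h δ = 0 ↔ Real.sin h = 0 := by
  have hlt := U20_mul_sqrt_lt hΓ
  obtain ⟨h0, h1⟩ := hΓ
  have hpos : 0 < (1 - 2*Γh) * (3 + 2*Γh) :=
    mul_pos (by norm_num at h1; linarith) (by linarith)
  have hsqrt := Real.sqrt_pos.mpr hpos
  have hU : 0 ≤ U20 * Real.sqrt ((1 - 2*Γh) * (3 + 2*Γh)) :=
    mul_nonneg (by norm_num [U20]) hsqrt.le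
  have hfactor :
      0 < U10 * (2*Γh + 1) + U20 * Real.sqrt ((1 - 2*Γh) * (3 + 2*Γh)) * Real.cos h := by
    nlinarith [mul_nonneg hU (neg_le_iff_add_nonneg.mp (Real.neg_one_le_cos h))]
  have hcoeff : -(δ/6) ≠ 0 := neg_ne_zero.mpr (by positivity)
  have hne := mul_ne_zero (mul_ne_zero hcoeff hsqrt.ne') hfactor.ne'
  rw [FΓ_eq_mul hpos.le, mul_eq_zero_iff_left hne]

/-- for `Γ̂ ∈ [0,0.49]`, `U10·(2Γ̂+1) > U20·√((1−2Γ̂)(3+2Γ̂))`; hence for any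
solution of the rescaled coplanar system staying in `Γ̂ ∈ [0,0.49]` one has `Γ̂'(s) = 0` iff
`sin ĥ(s) = 0`. -/
theorem stmt19 :
    (∀ Γh ∈ Set.Icc (0:ℝ) 0.49,
      U20 * Real.sqrt ((1 - 2*Γh) * (3 + 2*Γh)) < U10 * (2*Γh + 1)) ∧
    (∀ δ : ℝ, 0 < δ → ∀ Γh hh : ℝ → ℝ, SolvesCP Γh hh δ →
      (∀ s : ℝ, Γh s ∈ Set.Icc (0:ℝ) 0.49) →
      ∀ s : ℝ, (deriv Γh s = 0 ↔ Real.sin (hh s) = 0)) := by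
  refine ⟨fun _ hΓ => U20_mul_sqrt_lt hΓ, fun δ hδ Γh hh hsol hmem s => ?_⟩
  rw [(hsol s).1.deriv]
  exact FΓ_eq_zero_iff hδ (hmem s)

end Secular
end
end
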